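/- Let F : ℝ^d → ℝ be convex and twice continuously differentiable with Hessian L-Lipschitz in spectral norm, let r : ℝ^d → ℝ be convex, and let w* be a global minimizer of F + r. Fix w_t, let H_t = ∇²F(w_t) be symmetric positive definite, and let ε ∈ (0, 1/2] and ε₀ ∈ (0, 1) with 2ε + ε₀ < 1. Suppose a symmetric positive definite matrix H̃_t satisfies (1−ε)H_t ⪯ H̃_t ⪯ (1+ε)H_t. Let p̃_t be the exact sub-sampled proximal Newton step, defined by w_t − p̃_t being the global minimizer of z ↦ (1/2)‖z − (w_t − H̃_t⁻¹∇F(w_t))‖_{H̃_t}² + r(z), and let p̃_t′ satisfy ‖p̃_t′ − p̃_t‖_{H̃_t} ≤ (ε₀/2)·‖p̃_t‖_{H̃_t}. Set w_{t+1}′ = w_t − p̃_t′ and Δ_t = w_t − w*. Then, with ε₁ = 2ε + ε₀, ‖w_{t+1}′ − w*‖_{H_t} ≤ (1/(1−ε₁))·( ε₁·‖Δ_t‖_{H_t} + (L/(2·√(σ_min(H_t))))·‖Δ_t‖₂² ). -/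

import Mathlib

open Matrix
open scoped RealInnerProductSpace

noncomputable section

/-- The `H`-weighted norm `‖x‖_H = √(xᵀHx)` of a vector in Euclidean space. -/
def normHE {d : ℕ} (H : Matrix (Fin d) (Fin d) ℝ) (x : EuclideanSpace ℝ (Fin d)) : ℝ :=
  Real.sqrt ⟪x, Matrix.toEuclideanLin H x⟫

/-- The smallest eigenvalue of a Hermitian matrix. -/
def sMin {d : ℕ} {H : Matrix (Fin d) (Fin d) ℝ} (hH : H.IsHermitian) : ℝ :=
  ⨅ i, hH.eigenvalues i


theorem aux_bilin {d : ℕ} (M H : EuclideanSpace ℝ (Fin d) →ₗ[ℝ] EuclideanSpace ℝ (Fin d))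
    (hM : M.IsSymmetric) (hH : H.IsSymmetric) (c : ℝ)
    (hpos : ∀ x, x ≠ 0 → 0 < ⟪x, H x⟫)
    (h1 : ∀ x, ⟪x, M x⟫ ≤ c * ⟪x, H x⟫) (h2 : ∀ x, -(c * ⟪x, H x⟫) ≤ ⟪x, M x⟫)
    (x y : EuclideanSpace ℝ (Fin d)) :
    ⟪x, M y⟫ ≤ c * (Real.sqrt ⟪x, H x⟫ * Real.sqrt ⟪y, H y⟫) := by
  by_cases hx : x = 0
  · simp [hx]
  by_cases hy : y = 0
  · simp [hy]
  have key : ∀ u v, ⟪u, M v⟫ ≤ c / 2 * (⟪u, H u⟫ + ⟪v, H v⟫) := by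
    intro u v
    have a1 := h1 (u + v)
    have a2 := h2 (u - v)
    have s1 : ⟪v, M u⟫ = ⟪u, M v⟫ := by rw [← hM v u, real_inner_comm]
    have s2 : ⟪v, H u⟫ = ⟪u, H v⟫ := by rw [← hH v u, real_inner_comm]
    simp only [map_add, map_sub, inner_add_left, inner_add_right, inner_sub_left,
      inner_sub_right, s1, s2] at a1 a2
    linarith
  have px := hpos x hx
  have py := hpos y hy
  set a := Real.sqrt ⟪x, H x⟫ with ha
  set b := Real.sqrt ⟪y, H y⟫ with hb
  have pa : 0 < a := Real.sqrt_pos.2 px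
  have pb : 0 < b := Real.sqrt_pos.2 py
  have qa : ⟪x, H x⟫ = a ^ 2 := (Real.sq_sqrt px.le).symm
  have qb : ⟪y, H y⟫ = b ^ 2 := (Real.sq_sqrt py.le).symm
  have k := key (b • x) (a • y)
  simp only [map_smul, inner_smul_left, inner_smul_right, qa, qb, RCLike.conj_to_real] at k
  have pab : 0 < a * b := mul_pos pa pb
  refine le_of_mul_le_mul_left ?_ pab
  nlinarith [k]

theorem aux_tri {d : ℕ} (H : EuclideanSpace ℝ (Fin d) →ₗ[ℝ] EuclideanSpace ℝ (Fin d))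
    (hH : H.IsSymmetric) (hpos : ∀ x, x ≠ 0 → 0 < ⟪x, H x⟫)
    (x y : EuclideanSpace ℝ (Fin d)) :
    Real.sqrt ⟪x + y, H (x + y)⟫ ≤ Real.sqrt ⟪x, H x⟫ + Real.sqrt ⟪y, H y⟫ := by
  have hnn : ∀ x, 0 ≤ ⟪x, H x⟫ := by
    intro x
    by_cases hx : x = 0
    · simp [hx]
    · exact (hpos x hx).le
  have k := aux_bilin H H hH hH 1 hpos (fun x => by linarith) (fun x => by linarith [hnn x]) x y
  rw [Real.sqrt_le_left (by positivity)]
  have s2 : ⟪y, H x⟫ = ⟪x, H y⟫ := by rw [← hH y x, real_inner_comm]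
  have e1 := Real.sq_sqrt (hnn x)
  have e2 := Real.sq_sqrt (hnn y)
  simp only [map_add, inner_add_left, inner_add_right, s2]
  nlinarith

theorem aux_opt {d : ℕ} (f r : EuclideanSpace ℝ (Fin d) → ℝ) (hr : ConvexOn ℝ Set.univ r)
    (a z : EuclideanSpace ℝ (Fin d)) (hmin : ∀ w, f a + r a ≤ f w + r w) (D : ℝ)
    (hD : HasDerivAt (fun s : ℝ => f (a + s • (z - a))) D 0) : 0 ≤ D + (r z - r a) := by
  have hg : HasDerivAt (fun s : ℝ => f (a + s • (z - a)) + s * (r z - r a)) (D + (r z - r a)) 0 := by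
    simpa using! hD.add ((hasDerivAt_id (0 : ℝ)).mul_const (r z - r a))
  have ht := hg.tendsto_slope_zero_right
  refine ge_of_tendsto ht ?_
  have : Set.Ioo (0 : ℝ) 1 ∈ nhdsWithin 0 (Set.Ioi 0) := Ioo_mem_nhdsGT one_pos
  filter_upwards [this] with s hs
  have h1 := hmin (a + s • (z - a))
  have h2 := hr.2 (Set.mem_univ a) (Set.mem_univ z) (by linarith [hs.2] : 0 ≤ 1 - s) hs.1.le
    (by ring)
  have e : (1 - s) • a + s • z = a + s • (z - a) := by module
  rw [e] at h2
  simp only [smul_eq_mul] at h2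
  simp only [zero_add, zero_smul, add_zero, zero_mul, smul_eq_mul]
  have := hs.1
  apply mul_nonneg (by positivity)
  linarith

theorem aux_sMin {d : ℕ} {H : Matrix (Fin d) (Fin d) ℝ} (hH : H.IsHermitian)
    (x : EuclideanSpace ℝ (Fin d)) :
    sMin hH * ‖x‖ ^ 2 ≤ ⟪x, Matrix.toEuclideanLin H x⟫ := by
  have hs : (Matrix.toEuclideanLin H).IsSymmetric := isSymmetric_toEuclideanLin_iff.mpr hH
  have hv : ∀ i, Matrix.toEuclideanLin H (hH.eigenvectorBasis i)
      = hH.eigenvalues i • hH.eigenvectorBasis i := by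
    intro i
    apply WithLp.ofLp_injective
    simpa using! hH.mulVec_eigenvectorBasis i
  rw [← hH.eigenvectorBasis.sum_inner_mul_inner x (Matrix.toEuclideanLin H x),
    ← real_inner_self_eq_norm_sq, ← hH.eigenvectorBasis.sum_inner_mul_inner x x, Finset.mul_sum]
  refine Finset.sum_le_sum fun i _ => ?_
  rw [← hs, hv, inner_smul_left, real_inner_comm x]
  have : sMin hH ≤ hH.eigenvalues i := ciInf_le (Set.finite_range _).bddBelow i
  simp only [RCLike.conj_to_real]
  nlinarith [mul_self_nonneg ⟪x, hH.eigenvectorBasis i⟫]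

theorem aux_sMin_pos {d : ℕ} [Nonempty (Fin d)] {H : Matrix (Fin d) (Fin d) ℝ} (hH : H.PosDef) :
    0 < sMin hH.1 := by
  obtain ⟨i, hi⟩ := exists_eq_ciInf_of_finite (f := hH.1.eigenvalues)
  unfold sMin
  rw [← hi]
  exact hH.eigenvalues_pos i

theorem aux_taylor {d : ℕ} (G : EuclideanSpace ℝ (Fin d) → EuclideanSpace ℝ (Fin d))
    (hG : Differentiable ℝ G) (L : ℝ)
    (Hess : EuclideanSpace ℝ (Fin d) → Matrix (Fin d) (Fin d) ℝ)
    (hHess : ∀ w y, fderiv ℝ G w y = Matrix.toEuclideanLin (Hess w) y)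
    (hLip : ∀ w w' x, ‖Matrix.toEuclideanLin (Hess w - Hess w') x‖ ≤ L * ‖w - w'‖ * ‖x‖)
    (w D : EuclideanSpace ℝ (Fin d)) :
    ‖G (w - D) - G w + Matrix.toEuclideanLin (Hess w) D‖ ≤ L / 2 * ‖D‖ ^ 2 := by
  set HD := Matrix.toEuclideanLin (Hess w) D with hHD
  have hf : ∀ s : ℝ, HasDerivAt (fun s : ℝ => G (w - s • D) - G w + s • HD)
      (Matrix.toEuclideanLin (Hess w - Hess (w - s • D)) D) s := by
    intro s
    have h1 : HasDerivAt (fun s : ℝ => w - s • D) (-D) s := by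
      simpa using! ((hasDerivAt_id s).smul_const D).const_sub w
    have h2 := ((hG (w - s • D)).hasFDerivAt.comp_hasDerivAt s h1)
    rw [hHess] at h2
    have h3 := (h2.sub_const (G w)).add ((hasDerivAt_id s).smul_const HD)
    convert! h3 using 1
    simp [hHD]
    abel
  have hB : ∀ s : ℝ, HasDerivAt (fun s : ℝ => L / 2 * ‖D‖ ^ 2 * s ^ 2) (L * ‖D‖ ^ 2 * s) s := by
    intro s
    have := (hasDerivAt_pow 2 s).const_mul (L / 2 * ‖D‖ ^ 2)
    convert! this using 1
    simp
    ring
  have := image_norm_le_of_norm_deriv_right_le_deriv_boundary (a := 0) (b := 1)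
    (f := fun s : ℝ => G (w - s • D) - G w + s • HD)
    (fun s _ => (hf s).continuousAt.continuousWithinAt)
    (fun s _ => (hf s).hasDerivWithinAt) (by simp) hB
    (fun s hs => by
      refine (hLip _ _ _).trans (le_of_eq ?_)
      rw [sub_sub_cancel, norm_smul, Real.norm_of_nonneg hs.1]
      ring) (Set.right_mem_Icc.2 zero_le_one)
  simpa using this

theorem aux_arith (ε ε₀ a b R n q nt pt P : ℝ) (hε : 0 < ε ∧ ε ≤ 1 / 2) (h0 : 0 < ε₀)
    (hs : 2 * ε + ε₀ < 1) (ha : 0 ≤ a) (hb : 0 ≤ b) (hR : 0 ≤ R)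
    (h1 : (1 - ε) * b ^ 2 ≤ (ε * a + R) * b) (hq : q ≤ b + n)
    (hnt : 0 ≤ nt) (hpt : 0 ≤ pt) (hP : 0 ≤ P)
    (hn1 : (1 - ε) * n ^ 2 ≤ nt ^ 2) (hn2 : nt ≤ ε₀ / 2 * pt) (hp : pt ^ 2 ≤ (1 + ε) * P ^ 2)
    (hPab : P ≤ a + b) :
    q ≤ (1 / (1 - (2 * ε + ε₀))) * ((2 * ε + ε₀) * a + R) := by
  have hb' : (1 - ε) * b ≤ ε * a + R := by
    rcases hb.eq_or_lt with h | h
    · rw [← h]; nlinarith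
    · refine le_of_mul_le_mul_right ?_ h
      nlinarith
  have hn : n ≤ ε₀ * (a + b) := by
    refine (le_abs_self n).trans (abs_le_of_sq_le_sq' ?_ (by positivity) |> abs_le.2)
    have e1 : nt ^ 2 ≤ (ε₀ / 2 * pt) ^ 2 := by gcongr
    have e2 : P ^ 2 ≤ (a + b) ^ 2 := by gcongr
    have e3 : (ε₀ / 2 * pt) ^ 2 ≤ (ε₀ / 2) ^ 2 * ((1 + ε) * P ^ 2) := by
      rw [mul_pow]; gcongr
    have e4 : (ε₀ / 2) ^ 2 * ((1 + ε) * P ^ 2) ≤ (ε₀ / 2) ^ 2 * ((4 * (1 - ε)) * (a + b) ^ 2) := by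
      gcongr <;> linarith
    refine le_of_mul_le_mul_left ?_ (by linarith : 0 < 1 - ε)
    nlinarith
  rw [one_div, inv_mul_eq_div, le_div_iff₀ (by linarith)]
  have : q ≤ b + ε₀ * (a + b) := by linarith
  have t1 : q * (1 - (2 * ε + ε₀)) ≤ (b + ε₀ * (a + b)) * (1 - (2 * ε + ε₀)) := by
    gcongr
  have t2 : (1 + ε₀) * (1 - (2 * ε + ε₀)) * b ≤ (1 - ε) * b := by
    gcongr; nlinarith
  have t3 : ε₀ * (1 - (2 * ε + ε₀)) * a ≤ ε₀ * a := by
    gcongr; nlinarith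
  nlinarith

theorem aux_pos {d : ℕ} {H : Matrix (Fin d) (Fin d) ℝ} (hH : H.PosDef)
    (x : EuclideanSpace ℝ (Fin d)) (hx : x ≠ 0) : 0 < ⟪x, Matrix.toEuclideanLin H x⟫ := by
  have : Nonempty (Fin d) := by
    by_contra h
    rw [not_nonempty_iff] at h
    exact hx (Subsingleton.elim _ _)
  have := aux_sMin hH.1 x
  have h2 := aux_sMin_pos hH
  have h3 : 0 < ‖x‖ := norm_pos_iff.2 hx
  exact lt_of_lt_of_le (by positivity) this

theorem aux_psd {d : ℕ} {H : Matrix (Fin d) (Fin d) ℝ} (hH : H.PosSemidef)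
    (x : EuclideanSpace ℝ (Fin d)) : 0 ≤ ⟪x, Matrix.toEuclideanLin H x⟫ := by
  have := (Matrix.isPositive_toEuclideanLin_iff.2 hH).2 x
  rw [real_inner_comm]
  simpa using this

/-- error recursion for sub-sampled proximal Newton with an inexactly solved
subproblem. The exact step `p̃_t` is defined by `w_t − p̃_t = prox_r^{H̃_t}(w_t − H̃_t⁻¹∇F(w_t))`,
and the inexact step `p̃_t′` satisfies `‖p̃_t′ − p̃_t‖_{H̃_t} ≤ (ε₀/2)‖p̃_t‖_{H̃_t}`. -/
theorem sspn_inexact_error_recursion {d : ℕ}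
    (F : EuclideanSpace ℝ (Fin d) → ℝ)
    (hFconv : ConvexOn ℝ Set.univ F) (hF : ContDiff ℝ 2 F)
    (L : ℝ)
    (Hess : EuclideanSpace ℝ (Fin d) → Matrix (Fin d) (Fin d) ℝ)
    (hHess : ∀ w y, fderiv ℝ (gradient F) w y = Matrix.toEuclideanLin (Hess w) y)
    (hLip : ∀ w w' x, ‖Matrix.toEuclideanLin (Hess w - Hess w') x‖ ≤ L * ‖w - w'‖ * ‖x‖)
    (r : EuclideanSpace ℝ (Fin d) → ℝ) (hr : ConvexOn ℝ Set.univ r)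
    (wstar : EuclideanSpace ℝ (Fin d)) (hmin : ∀ w, F wstar + r wstar ≤ F w + r w)
    (wt : EuclideanSpace ℝ (Fin d)) (hHt : (Hess wt).PosDef)
    (ε : ℝ) (hε : 0 < ε ∧ ε ≤ 1 / 2)
    (ε₀ : ℝ) (hε₀ : 0 < ε₀ ∧ ε₀ < 1) (hsum : 2 * ε + ε₀ < 1)
    (Htil : Matrix (Fin d) (Fin d) ℝ) (hHtil : Htil.PosDef)
    (happrox : (Htil - (1 - ε) • Hess wt).PosSemidef ∧ ((1 + ε) • Hess wt - Htil).PosSemidef)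
    (ptil : EuclideanSpace ℝ (Fin d))
    (hptil : ∀ z,
      (1 / 2) * normHE Htil ((wt - ptil) -
          (wt - Matrix.toEuclideanLin Htil⁻¹ (gradient F wt))) ^ 2 + r (wt - ptil) ≤
        (1 / 2) * normHE Htil (z -
          (wt - Matrix.toEuclideanLin Htil⁻¹ (gradient F wt))) ^ 2 + r z)
    (ptil' : EuclideanSpace ℝ (Fin d))
    (hinexact : normHE Htil (ptil' - ptil) ≤ (ε₀ / 2) * normHE Htil ptil)
    (wnext' : EuclideanSpace ℝ (Fin d)) (hupdate : wnext' = wt - ptil') :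
    normHE (Hess wt) (wnext' - wstar) ≤
      (1 / (1 - (2 * ε + ε₀))) * ((2 * ε + ε₀) * normHE (Hess wt) (wt - wstar)
        + (L / (2 * Real.sqrt (sMin hHt.1))) * ‖wt - wstar‖ ^ 2) := by
  have hGd : Differentiable ℝ (gradient F) := by
    have h1 : ContDiff ℝ 1 (fderiv ℝ F) := hF.fderiv_right (by norm_num)
    have h2 : Differentiable ℝ (fderiv ℝ F) := h1.differentiable (by norm_num)
    exact (InnerProductSpace.toDual ℝ (EuclideanSpace ℝ (Fin d))).symm.differentiable.comp h2
  set T := Matrix.toEuclideanLin (Hess wt) with hT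
  set S := Matrix.toEuclideanLin Htil with hS
  have hTs : T.IsSymmetric := isSymmetric_toEuclideanLin_iff.mpr hHt.1
  have hSs : S.IsSymmetric := isSymmetric_toEuclideanLin_iff.mpr hHtil.1
  have hTp := aux_pos hHt
  have hSp := aux_pos hHtil
  have hTn := aux_psd hHt.posSemidef
  have hSn := aux_psd hHtil.posSemidef
  rw [← hT] at hTp hTn
  rw [← hS] at hSp hSn
  have hlow : ∀ x, (1 - ε) * ⟪x, T x⟫ ≤ ⟪x, S x⟫ := by
    intro x
    have := aux_psd happrox.1 x
    simp only [map_sub, map_smul, LinearMap.sub_apply, LinearMap.smul_apply, inner_sub_right,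
      inner_smul_right] at this
    linarith
  have hup : ∀ x, ⟪x, S x⟫ ≤ (1 + ε) * ⟪x, T x⟫ := by
    intro x
    have := aux_psd happrox.2 x
    simp only [map_sub, map_smul, LinearMap.sub_apply, LinearMap.smul_apply, inner_sub_right,
      inner_smul_right] at this
    linarith
  have hSinv : ∀ g, S (Matrix.toEuclideanLin Htil⁻¹ g) = g := by
    intro g
    have hu : IsUnit Htil.det := (Matrix.isUnit_iff_isUnit_det _).1 hHtil.isUnit
    apply WithLp.ofLp_injective
    simp [hS, Matrix.toLpLin_apply, Matrix.mulVec_mulVec, Matrix.mul_nonsing_inv _ hu]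
  set g := gradient F wt with hg
  set gs := gradient F wstar with hgs
  set e := wt - ptil - wstar with he
  set Δ := wt - wstar with hΔ
  have opt1 : 0 ≤ ⟪gs, e⟫ + (r (wt - ptil) - r wstar) := by
    apply aux_opt F r hr wstar (wt - ptil) hmin
    have h1 : HasDerivAt (fun s : ℝ => wstar + s • e) e 0 := by
      simpa using! ((hasDerivAt_id (0 : ℝ)).smul_const e).const_add wstar
    have h2 : HasFDerivAt F (fderiv ℝ F wstar) (wstar + (0 : ℝ) • e) := by
      simpa using (hF.differentiable (by norm_num) wstar).hasFDerivAt
    have h3 := h2.comp_hasDerivAt (0 : ℝ) h1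
    have h4 : fderiv ℝ F wstar e = ⟪gs, e⟫ := by
      rw [← toDual_gradient, InnerProductSpace.toDual_apply_apply]
    rw [h4] at h3
    exact h3
  have opt2 : 0 ≤ ⟪g - S ptil, -e⟫ + (r wstar - r (wt - ptil)) := by
    apply aux_opt (fun z => (1 / 2) * normHE Htil (z -
          (wt - Matrix.toEuclideanLin Htil⁻¹ g)) ^ 2) r hr (wt - ptil) wstar hptil
    set u := Matrix.toEuclideanLin Htil⁻¹ g with hu
    have hSu : S u = g := hSinv g
    have e1 : ∀ s : ℝ, (1 / 2) * normHE Htil (wt - ptil + s • (wstar - (wt - ptil)) -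
        (wt - u)) ^ 2 = 1 / 2 * ⟪u - ptil, g - S ptil⟫ + s * ⟪g - S ptil, -e⟫
          + s ^ 2 * (1 / 2 * ⟪e, S e⟫) := by
      intro s
      have e2 : wt - ptil + s • (wstar - (wt - ptil)) - (wt - u) = (u - ptil) + s • (-e) := by
        rw [he]; module
      rw [e2, normHE, Real.sq_sqrt (hSn _)]
      have e3 : S (u - ptil) = g - S ptil := by rw [map_sub, hSu]
      have e4 : ⟪u - ptil, S e⟫ = ⟪g - S ptil, e⟫ := by rw [← hSs, e3]
      rw [map_add, map_smul, map_neg, e3]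
      simp only [inner_add_left, inner_add_right, inner_smul_left, inner_smul_right,
        inner_neg_left, inner_neg_right, RCLike.conj_to_real, e4]
      rw [real_inner_comm (g - S ptil) e]
      ring
    simp only [e1]
    have d1 := ((hasDerivAt_id (0 : ℝ)).mul_const ⟪g - S ptil, -e⟫).const_add
      (1 / 2 * ⟪u - ptil, g - S ptil⟫)
    have d2 := (hasDerivAt_pow 2 (0 : ℝ)).mul_const (1 / 2 * ⟪e, S e⟫)
    simpa using! d1.add d2
  have hpe : ptil = Δ - e := by rw [he, hΔ]; abel
  have tay := aux_taylor (gradient F) hGd L Hess hHess hLip wt Δ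
  rw [← hT, ← hg, show wt - Δ = wstar by rw [hΔ]; abel, ← hgs] at tay
  have cs := real_inner_le_norm e (gs - g + T Δ)
  have bil := aux_bilin (S - T) T (hSs.sub hTs) hTs ε hTp
    (fun x => by
      have := hup x
      simp only [LinearMap.sub_apply, inner_sub_right]; linarith)
    (fun x => by
      have := hlow x
      simp only [LinearMap.sub_apply, inner_sub_right]; linarith) e Δ
  have hL : 0 ≤ L * ‖Δ‖ ^ 2 := by
    have := (norm_nonneg _).trans (hLip wt wstar Δ)
    rw [← hΔ] at this
    linarith
  set R := (L / (2 * Real.sqrt (sMin hHt.1))) * ‖Δ‖ ^ 2 with hR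
  have hR0 : 0 ≤ R := by
    rw [hR, div_mul_eq_mul_div]
    positivity
  have hRe : ‖e‖ * (L / 2 * ‖Δ‖ ^ 2) ≤ R * normHE (Hess wt) e := by
    by_cases h0 : e = 0
    · simp [h0, normHE]
    have : Nonempty (Fin d) := by
      by_contra h
      rw [not_nonempty_iff] at h
      exact h0 (Subsingleton.elim _ _)
    have hsp := aux_sMin_pos hHt
    have hsq : 0 < Real.sqrt (sMin hHt.1) := Real.sqrt_pos.2 hsp
    have k : Real.sqrt (sMin hHt.1) * ‖e‖ ≤ normHE (Hess wt) e := by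
      apply Real.le_sqrt_of_sq_le
      rw [mul_pow, Real.sq_sqrt hsp.le]
      exact aux_sMin hHt.1 e
    calc ‖e‖ * (L / 2 * ‖Δ‖ ^ 2) = R * (Real.sqrt (sMin hHt.1) * ‖e‖) := by
          rw [hR]; field_simp
      _ ≤ _ := by gcongr
  have nsq : ∀ x, normHE (Hess wt) x ^ 2 = ⟪x, T x⟫ := fun x => Real.sq_sqrt (hTn x)
  have ssq : ∀ x, normHE Htil x ^ 2 = ⟪x, S x⟫ := fun x => Real.sq_sqrt (hSn x)
  have nn : ∀ H : Matrix (Fin d) (Fin d) ℝ, ∀ x, 0 ≤ normHE H x := fun H x => Real.sqrt_nonneg _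
  have neg : ∀ x, normHE (Hess wt) (-x) = normHE (Hess wt) x := by
    intro x; simp [normHE]
  have tri : ∀ x y, normHE (Hess wt) (x + y) ≤ normHE (Hess wt) x + normHE (Hess wt) y :=
    aux_tri T hTs hTp
  refine aux_arith ε ε₀ (normHE (Hess wt) Δ) (normHE (Hess wt) e) R
    (normHE (Hess wt) (ptil' - ptil)) _ (normHE Htil (ptil' - ptil)) (normHE Htil ptil)
    (normHE (Hess wt) ptil) hε hε₀.1 hsum (nn _ _) (nn _ _) hR0 ?_ ?_ (nn _ _) (nn _ _) (nn _ _)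
    ?_ hinexact ?_ ?_
  · rw [nsq]
    refine (hlow e).trans ?_
    have bil' : ⟪e, (S - T) Δ⟫ ≤ ε * (normHE (Hess wt) e * normHE (Hess wt) Δ) := bil
    have cs2 : ‖e‖ * ‖gs - g + T Δ‖ ≤ ‖e‖ * (L / 2 * ‖Δ‖ ^ 2) := by gcongr
    rw [show S ptil = S Δ - S e by rw [hpe, map_sub]] at opt2
    simp only [LinearMap.sub_apply, inner_sub_right, inner_sub_left, inner_add_right,
      inner_neg_right] at bil' cs opt2
    have c1 := real_inner_comm e gs
    have c2 := real_inner_comm e g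
    have c3 := real_inner_comm e (S Δ)
    have c4 := real_inner_comm e (S e)
    linarith
  · have : wnext' - wstar = e + -(ptil' - ptil) := by rw [hupdate, he]; abel
    rw [this]
    exact (tri _ _).trans (by rw [neg])
  · rw [nsq, ssq]; exact hlow _
  · rw [nsq, ssq]; exact hup _
  · have := tri Δ (-e)
    rwa [neg, ← sub_eq_add_neg, ← hpe] at this
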